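/- arXiv:2512.24158 — 3 statements merged into one kernel-verified Lean document; each statement's English description precedes it below -/
import Mathlib

section
/- Let N ≥ 2 and let S̃_N be Schur's double cover of the symmetric group, presented by generators z, t_1, …, t_{N−1} with relations z² = 1, t_i² = z, (t_i t_{i+1})³ = z, and (t_i t_j)² = z for |i − j| ≥ 2. Then for all integers a ≥ 1 and n ≥ 1 with a + n − 1 ≤ N − 1, one has (t_a t_{a+1} ⋯ t_{a+n−1})^{n+1} = z^{n(n²−3n+4)/2} · (t_a t_{a+1} ⋯ t_{a+n−2})^{n} in S̃_N. -/
/-!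
Schur's double cover `S̃_N` of the symmetric group, presented by generators
`z, t_1, …, t_{N-1}` and relations `z² = 1`, `t_i² = z`, `(t_i t_{i+1})³ = z`,
`(t_i t_j)² = z` for `|i − j| ≥ 2`.

Generators are indexed by `Option (Fin (N-1))`: `none` is the central element `z`
and `some i` is `t_{i+1}` (so `some i` for `i = 0, …, N-2` are `t_1, …, t_{N-1}`).
-/

abbrev SchurGen (N : ℕ) := Option (Fin (N - 1))

namespace Schur

/-- The relator `z` as an element of the free group. -/
def zf (N : ℕ) : FreeGroup (SchurGen N) := FreeGroup.of none

/-- The generator `t_{i+1}` as an element of the free group. -/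
def tf (N : ℕ) (i : Fin (N - 1)) : FreeGroup (SchurGen N) := FreeGroup.of (some i)

/-- The defining relators of Schur's double cover. -/
def rels (N : ℕ) : Set (FreeGroup (SchurGen N)) :=
  { r | r = zf N ^ 2 ∨
        (∃ i, r = tf N i ^ 2 * (zf N)⁻¹) ∨
        (∃ i j : Fin (N - 1), (i : ℕ) + 1 = (j : ℕ) ∧
          r = (tf N i * tf N j) ^ 3 * (zf N)⁻¹) ∨
        (∃ i j : Fin (N - 1), ((i : ℕ) + 2 ≤ (j : ℕ) ∨ (j : ℕ) + 2 ≤ (i : ℕ)) ∧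
          r = (tf N i * tf N j) ^ 2 * (zf N)⁻¹) }

/-- Schur's double cover `S̃_N` of the symmetric group `S_N`. -/
abbrev Cover (N : ℕ) := PresentedGroup (rels N)

/-- The central element `z` of `S̃_N`. -/
def z (N : ℕ) : Cover N := PresentedGroup.of none

/-- The generator `t_{i+1}` of `S̃_N` (0-indexed). -/
def t (N : ℕ) (i : Fin (N - 1)) : Cover N := PresentedGroup.of (some i)

/-- The generator `t_i` of `S̃_N`, 1-indexed: meaningful for `1 ≤ i ≤ N-1`
(junk value `1` outside this range). -/
def T (N i : ℕ) : Cover N := if h : i - 1 < N - 1 then t N ⟨i - 1, h⟩ else 1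

/-- The product `t_a t_{a+1} ⋯ t_{a+n-1}` (`n` consecutive generators, 1-indexed). -/
def P (N a n : ℕ) : Cover N := ((List.range n).map fun j => T N (a + j)).prod

end Schur

namespace Schur

section TwistedBraid

variable {G : Type*} [Group G] {ζ : G} {s : ℕ → G} {m : ℕ}

/-- The product `s p * s (p - 1) * ⋯` of `k` factors with descending indices. -/
def descProd (s : ℕ → G) (p k : ℕ) : G := ((List.range k).map fun j => s (p - j)).prod

/-- The product `s 0 * s 1 * ⋯ * s (k - 1)`. -/
def ascProd (s : ℕ → G) (k : ℕ) : G := ((List.range k).map s).prod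

theorem ascProd_zero (s : ℕ → G) : ascProd s 0 = 1 := rfl

theorem ascProd_succ (s : ℕ → G) (k : ℕ) : ascProd s (k + 1) = ascProd s k * s k := by
  simp [ascProd, List.range_succ]

theorem descProd_zero (s : ℕ → G) (p : ℕ) : descProd s p 0 = 1 := rfl

theorem descProd_succ (s : ℕ → G) (p k : ℕ) :
    descProd s p (k + 1) = descProd s p k * s (p - k) := by
  simp [descProd, List.range_succ]

theorem descProd_succ' (s : ℕ → G) (p k : ℕ) :
    descProd s p (k + 1) = s p * descProd s (p - 1) k := by
  simp only [descProd, List.range_succ_eq_map, List.map_cons, List.prod_cons, List.map_map,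
    Nat.sub_zero]
  congr 3
  funext j
  simp only [Function.comp_apply]
  congr 1
  omega

theorem ascProd_mul_of_lt (hζ : ∀ g, Commute ζ g)
    (hfar : ∀ i j, i + 2 ≤ j → j < m → s i * s j = ζ * (s j * s i))
    {k j : ℕ} (hkj : k < j) (hj : j < m) :
    ascProd s k * s j = ζ ^ k * (s j * ascProd s k) := by
  induction k with
  | zero => simp [ascProd_zero]
  | succ k ih =>
    calc ascProd s (k + 1) * s j
        = ascProd s k * (s k * s j) := by rw [ascProd_succ, mul_assoc]
      _ = ζ * (ascProd s k * s j) * s k := by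
        rw [hfar k j (by omega) hj, ← mul_assoc, ← (hζ (ascProd s k)).eq]
        simp only [mul_assoc]
      _ = ζ ^ (k + 1) * (s j * ascProd s (k + 1)) := by
        rw [ih (by omega), ascProd_succ, pow_succ']
        simp only [mul_assoc]

/-- Twisted conjugation by `s 0 * ⋯ * s (n - 1)` shifts the index of a generator by one. -/
theorem ascProd_mul_shift (hζ : ∀ g, Commute ζ g) (hζ2 : ζ ^ 2 = 1)
    (hfar : ∀ i j, i + 2 ≤ j → j < m → s i * s j = ζ * (s j * s i))
    (hbraid : ∀ i, i + 1 < m → s i * s (i + 1) * s i = s (i + 1) * s i * s (i + 1))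
    {i n : ℕ} (hi : i + 2 ≤ n) (hn : n ≤ m) :
    ascProd s n * s i = ζ ^ n * (s (i + 1) * ascProd s n) := by
  induction n, hi using Nat.le_induction with
  | base =>
    calc ascProd s (i + 2) * s i
        = ascProd s i * (s i * s (i + 1) * s i) := by simp only [ascProd_succ, mul_assoc]
      _ = ascProd s i * s (i + 1) * (s i * s (i + 1)) := by
        rw [hbraid i (by omega)]
        simp only [mul_assoc]
      _ = ζ ^ (i + 2) * (s (i + 1) * ascProd s (i + 2)) := by
        rw [ascProd_mul_of_lt hζ hfar (Nat.lt_succ_self i) (by omega), pow_add, hζ2]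
        simp only [ascProd_succ, mul_assoc, mul_one]
  | succ n hin ih =>
    have hsw : s n * s i = ζ * (s i * s n) := by
      rw [hfar i n hin (by omega), ← mul_assoc, ← sq, hζ2, one_mul]
    calc ascProd s (n + 1) * s i
        = ζ * (ascProd s n * s i) * s n := by
          rw [ascProd_succ, mul_assoc, hsw, ← mul_assoc, ← (hζ (ascProd s n)).eq]
          simp only [mul_assoc]
      _ = ζ ^ (n + 1) * (s (i + 1) * ascProd s (n + 1)) := by
        rw [ih (by omega), ascProd_succ, pow_succ']
        simp only [mul_assoc]

theorem descProd_mul_ascProd_shift (hζ : ∀ g, Commute ζ g) (hζ2 : ζ ^ 2 = 1)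
    (hfar : ∀ i j, i + 2 ≤ j → j < m → s i * s j = ζ * (s j * s i))
    (hbraid : ∀ i, i + 1 < m → s i * s (i + 1) * s i = s (i + 1) * s i * s (i + 1))
    {k n : ℕ} (hk : k ≤ n) (hn : n + 1 ≤ m) :
    descProd s n k * ascProd s (n + 1) =
      ζ ^ ((n + 1) * k) * (ascProd s (n + 1) * descProd s (n - 1) k) := by
  induction k with
  | zero => simp [descProd_zero]
  | succ k ih =>
    have hshift : s (n - k) * ascProd s (n + 1) =
        ζ ^ (n + 1) * (ascProd s (n + 1) * s (n - 1 - k)) := by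
      rw [ascProd_mul_shift hζ hζ2 hfar hbraid (by omega) hn, ← mul_assoc, ← pow_add, ← two_mul,
        pow_mul, hζ2, one_pow, one_mul]
      congr 2
      omega
    calc descProd s n (k + 1) * ascProd s (n + 1)
        = descProd s n k * ζ ^ (n + 1) * (ascProd s (n + 1) * s (n - 1 - k)) := by
          rw [descProd_succ, mul_assoc, hshift, mul_assoc]
      _ = ζ ^ (n + 1) * (descProd s n k * ascProd s (n + 1)) * s (n - 1 - k) := by
        rw [← ((hζ (descProd s n k)).pow_left (n + 1)).eq]
        simp only [mul_assoc]
      _ = ζ ^ ((n + 1) * (k + 1)) * (ascProd s (n + 1) * descProd s (n - 1) (k + 1)) := by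
        rw [ih (by omega), descProd_succ, mul_add_one, add_comm (_ * k), pow_add ζ (n + 1)]
        simp only [mul_assoc]

theorem ascProd_succ_pow (hζ : ∀ g, Commute ζ g) (hζ2 : ζ ^ 2 = 1)
    (hfar : ∀ i j, i + 2 ≤ j → j < m → s i * s j = ζ * (s j * s i))
    (hbraid : ∀ i, i + 1 < m → s i * s (i + 1) * s i = s (i + 1) * s i * s (i + 1))
    {k n : ℕ} (hk : k ≤ n + 1) (hn : n + 1 ≤ m) :
    ascProd s (n + 1) ^ k =
      ζ ^ ((n + 1) * k.choose 2) * (ascProd s n ^ k * descProd s n k) := by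
  induction k with
  | zero => simp [descProd_zero]
  | succ k ih =>
    calc ascProd s (n + 1) ^ (k + 1)
        = ζ ^ ((n + 1) * k.choose 2) *
            (ascProd s n ^ k * (descProd s n k * ascProd s (n + 1))) := by
          rw [pow_succ, ih (by omega)]
          simp only [mul_assoc]
      _ = ζ ^ ((n + 1) * k.choose 2) * (ζ ^ ((n + 1) * k) * ascProd s n ^ k *
            (ascProd s (n + 1) * descProd s (n - 1) k)) := by
        rw [descProd_mul_ascProd_shift hζ hζ2 hfar hbraid (by omega) hn,
          ((hζ (ascProd s n ^ k)).pow_left ((n + 1) * k)).eq]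
        simp only [mul_assoc]
      _ = ζ ^ ((n + 1) * (k + 1).choose 2) *
            (ascProd s n ^ (k + 1) * descProd s n (k + 1)) := by
        rw [descProd_succ', ascProd_succ, Nat.choose_succ_succ' k 1, Nat.choose_one_right,
          mul_add, add_comm ((n + 1) * k), pow_add, pow_succ]
        simp only [mul_assoc]

theorem descProd_mul_ascProd (hζ : ∀ g, Commute ζ g) (hsq : ∀ i, i < m → s i ^ 2 = ζ)
    {n : ℕ} (hn : n + 1 ≤ m) :
    descProd s n (n + 1) * ascProd s (n + 1) = ζ ^ (n + 1) := by
  induction n with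
  | zero => simpa [descProd, ascProd, sq] using hsq 0 hn
  | succ n ih =>
    calc descProd s (n + 1) (n + 1 + 1) * ascProd s (n + 1 + 1)
        = s (n + 1) * (descProd s n (n + 1) * ascProd s (n + 1)) * s (n + 1) := by
          rw [descProd_succ', ascProd_succ s (n + 1), Nat.add_sub_cancel]
          simp only [mul_assoc]
      _ = ζ ^ (n + 1 + 1) := by
        rw [ih (by omega), ← ((hζ (s (n + 1))).pow_left (n + 1)).eq, mul_assoc, ← sq,
          hsq _ (by omega), ← pow_succ]

theorem ascProd_succ_pow_add_two (hζ : ∀ g, Commute ζ g) (hζ2 : ζ ^ 2 = 1)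
    (hsq : ∀ i, i < m → s i ^ 2 = ζ)
    (hfar : ∀ i j, i + 2 ≤ j → j < m → s i * s j = ζ * (s j * s i))
    (hbraid : ∀ i, i + 1 < m → s i * s (i + 1) * s i = s (i + 1) * s i * s (i + 1))
    {n : ℕ} (hn : n + 1 ≤ m) :
    ascProd s (n + 1) ^ (n + 2) =
      ζ ^ ((n + 1) * (n + 1).choose 2 + (n + 1)) * ascProd s n ^ (n + 1) := by
  rw [pow_succ, ascProd_succ_pow hζ hζ2 hfar hbraid le_rfl hn, mul_assoc, mul_assoc,
    descProd_mul_ascProd hζ hsq hn, ← ((hζ (ascProd s n ^ (n + 1))).pow_left (n + 1)).eq,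
    ← mul_assoc, ← pow_add]

end TwistedBraid

theorem z_sq (N : ℕ) : z N ^ 2 = 1 :=
  PresentedGroup.one_of_mem (rels := rels N) (Or.inl rfl)

theorem t_sq (N : ℕ) (i : Fin (N - 1)) : t N i ^ 2 = z N :=
  mul_inv_eq_one.mp
    (PresentedGroup.one_of_mem (rels := rels N) (Or.inr (Or.inl ⟨i, rfl⟩)))

theorem t_mul_t_pow_three (N : ℕ) {i j : Fin (N - 1)} (h : (i : ℕ) + 1 = j) :
    (t N i * t N j) ^ 3 = z N :=
  mul_inv_eq_one.mp
    (PresentedGroup.one_of_mem (rels := rels N) (Or.inr (Or.inr (Or.inl ⟨i, j, h, rfl⟩))))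

theorem t_mul_t_sq (N : ℕ) {i j : Fin (N - 1)} (h : (i : ℕ) + 2 ≤ j) :
    (t N i * t N j) ^ 2 = z N :=
  mul_inv_eq_one.mp
    (PresentedGroup.one_of_mem (rels := rels N)
      (Or.inr (Or.inr (Or.inr ⟨i, j, Or.inl h, rfl⟩))))

theorem commute_z (N : ℕ) (g : Cover N) : Commute (z N) g := by
  have hg : g ∈ Subgroup.closure (Set.range (PresentedGroup.of (rels := rels N))) := by
    rw [PresentedGroup.closure_range_of]
    trivial
  induction hg using Subgroup.closure_induction with
  | mem x hx =>
    obtain ⟨_ | i, rfl⟩ := hx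
    · exact Commute.refl _
    · have h : Commute (t N i ^ 2) (t N i) := (Commute.refl _).pow_left 2
      rwa [t_sq] at h
  | one => exact Commute.one_right _
  | mul x y _ _ hx hy => exact hx.mul_right hy
  | inv x _ hx => exact hx.inv_right

theorem t_inv (N : ℕ) (i : Fin (N - 1)) : (t N i)⁻¹ = z N * t N i := by
  rw [inv_eq_iff_mul_eq_one, (commute_z N _).eq, ← mul_assoc, ← sq, t_sq, ← sq, z_sq]

theorem t_mul_t_of_far (N : ℕ) {i j : Fin (N - 1)} (h : (i : ℕ) + 2 ≤ j) :
    t N i * t N j = z N * (t N j * t N i) := by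
  have hij := t_mul_t_sq N h
  rw [sq, ← eq_mul_inv_iff_mul_eq, mul_inv_rev, t_inv, t_inv] at hij
  have hz : z N * z N = 1 := by rw [← sq, z_sq]
  rw [hij, mul_assoc (z N) (t N j), ← mul_assoc (t N j), ← (commute_z N (t N j)).eq, mul_assoc,
    ← mul_assoc (z N) (z N), hz, one_mul]

theorem t_braid (N : ℕ) {i j : Fin (N - 1)} (h : (i : ℕ) + 1 = j) :
    t N i * t N j * t N i = t N j * t N i * t N j := by
  have hij := t_mul_t_pow_three N h
  have hz : z N * z N = 1 := by rw [← sq, z_sq]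
  have hinv : (t N j * t N i * t N j)⁻¹ = z N * (t N j * t N i * t N j) := by
    rw [mul_inv_rev, mul_inv_rev, t_inv, t_inv]
    have h1 := (commute_z N (t N j)).eq
    have h2 := (commute_z N (t N i)).eq
    calc z N * t N j * (z N * t N i * (z N * t N j))
        = z N * (t N j * z N) * (t N i * z N) * t N j := by simp only [mul_assoc]
      _ = z N * z N * (t N j * z N) * t N i * t N j := by
        rw [← h2]
        simp only [← mul_assoc]
        rw [mul_assoc (z N) (t N j) (z N), ← h1, ← mul_assoc, mul_assoc (z N * z N) (t N j) (z N),
          ← h1]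
      _ = z N * (t N j * t N i * t N j) := by
        rw [hz, ← h1]
        simp only [mul_assoc, one_mul]
  have hprod : t N i * t N j * t N i * (t N j * t N i * t N j) = z N := by
    rw [← hij, pow_succ, sq]
    simp only [mul_assoc]
  rw [← eq_mul_inv_iff_mul_eq, hinv, ← mul_assoc, hz, one_mul] at hprod
  exact hprod

theorem T_add_of_lt (N : ℕ) {a i : ℕ} (ha : 1 ≤ a) (h : a - 1 + i < N - 1) :
    T N (a + i) = t N ⟨a - 1 + i, h⟩ := by
  have h' : a + i - 1 = a - 1 + i := by omega
  simp only [T, h', h, dif_pos]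

end Schur

open Schur in
/-- Lemma: `(t_a t_{a+1} ⋯ t_{a+n-1})^{n+1} = z^{n(n²−3n+4)/2} (t_a ⋯ t_{a+n-2})^n`
in Schur's double cover `S̃_N`. -/
theorem schur_cycle_power_identity (N : ℕ) (hN : 2 ≤ N) (a n : ℕ) (ha : 1 ≤ a) (hn : 1 ≤ n)
    (hrange : a + n - 1 ≤ N - 1) :
    P N a n ^ (n + 1) =
      z N ^ (((n : ℤ) * ((n : ℤ) ^ 2 - 3 * (n : ℤ) + 4)) / 2) * P N a (n - 1) ^ n := by
  obtain ⟨n, rfl⟩ : ∃ k, n = k + 1 := ⟨n - 1, by omega⟩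
  have key := ascProd_succ_pow_add_two (s := fun j => T N (a + j)) (m := n + 1) (commute_z N)
    (z_sq N)
    (fun i hi => by
      rw [T_add_of_lt N ha (by omega), t_sq])
    (fun i j hij hj => by
      rw [T_add_of_lt N ha (by omega), T_add_of_lt N ha (by omega)]
      exact t_mul_t_of_far N (by simp only; omega))
    (fun i hi => by
      rw [T_add_of_lt N ha (by omega), T_add_of_lt N ha (by omega)]
      exact t_braid N (by simp only; omega))
    le_rfl
  have hchoose : (((n + 1).choose 2 : ℕ) : ℤ) * 2 = (n + 1) * n := by
    have h := Nat.add_one_mul_choose_eq n 1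
    rw [Nat.choose_one_right] at h
    exact_mod_cast h.symm
  have hexp : ((n + 1 : ℕ) : ℤ) * (((n + 1 : ℕ) : ℤ) ^ 2 - 3 * ((n + 1 : ℕ) : ℤ) + 4) / 2 =
      (((n + 1) * (n + 1).choose 2 + (n + 1) : ℕ) : ℤ) + 2 * -((n + 1).choose 2 : ℕ) := by
    apply Int.ediv_eq_of_eq_mul_left two_ne_zero
    push_cast
    linear_combination (1 - (n : ℤ)) * hchoose
  have hpow : z N ^ (2 * -(((n + 1).choose 2 : ℕ) : ℤ)) = 1 := by
    rw [zpow_mul, zpow_ofNat, z_sq, one_zpow]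
  rw [hexp, zpow_add, hpow, mul_one, zpow_natCast]
  exact key
end

section
/- Let V be a nonzero finite-dimensional complex vector space and let T, S : V → V be linear maps with S ∘ S = id and T ∘ S = S ∘ T. Then every eigenvalue μ of T ∘ S satisfies: μ is an eigenvalue of T or −μ is an eigenvalue of T. -/
/-- If `S` is an involution of a nonzero finite-dimensional complex vector space `V`
commuting with `T`, then every eigenvalue `μ` of `T ∘ S` satisfies: `μ` or `-μ` is an
eigenvalue of `T`. -/
theorem eigenvalue_comp_commuting_involution
    (V : Type) [AddCommGroup V] [Module ℂ V] [FiniteDimensional ℂ V] [Nontrivial V]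
    (T S : V →ₗ[ℂ] V) (hS : S ∘ₗ S = LinearMap.id)
    (hTS : T ∘ₗ S = S ∘ₗ T) (μ : ℂ)
    (hμ : Module.End.HasEigenvalue (T ∘ₗ S) μ) :
    Module.End.HasEigenvalue T μ ∨ Module.End.HasEigenvalue T (-μ) := by
  obtain ⟨v, hv⟩ := hμ.exists_hasEigenvector
  have hTSv : T (S v) = μ • v := hv.apply_eq_smul
  have hTv : T v = μ • S v := by
    calc T v = T (S (S v)) := congrArg T (LinearMap.congr_fun hS v).symm
      _ = S (T (S v)) := LinearMap.congr_fun hTS (S v)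
      _ = μ • S v := by rw [hTSv, map_smul]
  by_cases hw : v + S v = 0
  · right
    refine Module.End.hasEigenvalue_of_hasEigenvector (x := v)
      ⟨Module.End.mem_eigenspace_iff.mpr ?_, hv.2⟩
    rw [hTv, eq_neg_of_add_eq_zero_right hw, smul_neg, neg_smul]
  · left
    refine Module.End.hasEigenvalue_of_hasEigenvector (x := v + S v)
      ⟨Module.End.mem_eigenspace_iff.mpr ?_, hw⟩
    rw [map_add, hTv, hTSv, smul_add, add_comm]
end

section
/- Let V be a nonzero finite-dimensional complex vector space and let T, S : V → V be linear maps with S ∘ S = id and T ∘ S = −(S ∘ T). Then every eigenvalue μ of T ∘ S is of the form i·η or −i·η for some eigenvalue η of T (where i is the imaginary unit). -/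
/-- If `S` is an involution of a nonzero finite-dimensional complex vector space `V`
anticommuting with `T`, then every eigenvalue `μ` of `T ∘ S` is of the form `i·η` or
`-i·η` for some eigenvalue `η` of `T`. -/
theorem eigenvalue_comp_anticommuting_involution
    (V : Type) [AddCommGroup V] [Module ℂ V] [FiniteDimensional ℂ V] [Nontrivial V]
    (T S : V →ₗ[ℂ] V) (hS : S ∘ₗ S = LinearMap.id)
    (hTS : T ∘ₗ S = -(S ∘ₗ T)) (μ : ℂ)
    (hμ : Module.End.HasEigenvalue (T ∘ₗ S) μ) :
    ∃ η : ℂ, Module.End.HasEigenvalue T η ∧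
      (μ = Complex.I * η ∨ μ = -(Complex.I * η)) := by
  obtain ⟨v, hv⟩ := hμ.exists_hasEigenvector
  have hTSv : T (S v) = μ • v := hv.apply_eq_smul
  have hSS : S (S v) = v := LinearMap.congr_fun hS v
  have hanti : T (S (S v)) = -S (T (S v)) := LinearMap.congr_fun hTS (S v)
  have hTT : T (T v) = -(μ * μ) • v := by
    rw [hSS, hTSv, map_smul] at hanti
    rw [hanti, map_neg, map_smul, hTSv, smul_smul, neg_smul]
  by_cases hw : T v + (Complex.I * μ) • v = 0
  · refine ⟨-(Complex.I * μ), Module.End.hasEigenvalue_of_hasEigenvector (x := v)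
      (Module.End.hasEigenvector_iff.mpr ⟨?_, hv.2⟩), Or.inl ?_⟩
    · rw [Module.End.mem_eigenspace_iff, neg_smul]
      exact eq_neg_of_add_eq_zero_left hw
    · linear_combination μ * Complex.I_mul_I
  · refine ⟨Complex.I * μ, Module.End.hasEigenvalue_of_hasEigenvector
      (Module.End.hasEigenvector_iff.mpr ⟨?_, hw⟩), Or.inr ?_⟩
    · rw [Module.End.mem_eigenspace_iff, map_add, map_smul, hTT, smul_add, smul_smul,
        add_comm]
      congr 2
      linear_combination -μ * μ * Complex.I_mul_I
    · linear_combination μ * Complex.I_mul_I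
end
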